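/- Fix a unit μ ∈ k^×. The μ-central GMV operator σ : A^{(2)} → A^{(2)} (given by a₁ ↦ T₁a₂, a₁^* ↦ a₂^*T₁^{-1}, a₂ ↦ a₁, a₂^* ↦ a₁^*, the identity on the objects {0,1}) is a Reidemeister operator in the category of k-linear categories with fixed object set {0,1} and identity-on-objects k-linear functors: σ is invertible, σ^R_U = (σ∘i₂, i₂) and σ^L_U = (σ∘i₁, i₁) are invertible, σ is Wada, and its torsion is the automorphism χ : A → A given by a ↦ Ta, a^* ↦ a^*T^{-1}, which is invertible. -/

import Mathlib

/-!
STATEMENT 6: The μ-central GMV operator σ : A^{(2)} → A^{(2)} is a Reidemeister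
operator in the category C of k-linear categories with object set {0,1} and
identity-on-objects k-linear functors (encoded: k-algebras with a distinguished
idempotent e₀, and e₀-preserving algebra maps): σ is invertible, σ^R_U and σ^L_U
are invertible, σ satisfies the Yang–Baxter equation, σ is Wada (j' = p∘i₁ is
an isomorphism for the coequalizer (E,p) of i₂ and σ∘i₂ in C), and its torsion
is the automorphism χ : A → A, a ↦ Ta, a^* ↦ a^*T⁻¹, which is invertible.
-/

/-- Generators of the `k`-category `A^{(n)}` with two objects `{0,1}` (encoded as
a `k`-algebra with idempotents `e₀, e₁`): the identities `e₀, e₁` and the arrows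
`a_i : 1 → 0`, `a_i^* : 0 → 1`. -/
inductive PGen (n : ℕ) : Type
  | e0 : PGen n
  | e1 : PGen n
  | a : Fin n → PGen n
  | as : Fin n → PGen n

variable (k : Type) [CommRing k]

/-- The defining relations of `A^{(n)}`: `e₀, e₁` are orthogonal idempotents
summing to `1` (encoding the two objects), the arrows are placed in the correct
hom-components (`a_i = e₀ a_i e₁`, `a_i^* = e₁ a_i^* e₀`), and the μ-central
relations `a_i^* a_i = (μ − 1) e₁` hold. -/
inductive PRel (μ : k) (n : ℕ) : FreeAlgebra k (PGen n) → FreeAlgebra k (PGen n) → Prop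
  | idem0 : PRel μ n (FreeAlgebra.ι k PGen.e0 * FreeAlgebra.ι k PGen.e0) (FreeAlgebra.ι k PGen.e0)
  | idem1 : PRel μ n (FreeAlgebra.ι k PGen.e1 * FreeAlgebra.ι k PGen.e1) (FreeAlgebra.ι k PGen.e1)
  | orth01 : PRel μ n (FreeAlgebra.ι k PGen.e0 * FreeAlgebra.ι k PGen.e1) 0
  | orth10 : PRel μ n (FreeAlgebra.ι k PGen.e1 * FreeAlgebra.ι k PGen.e0) 0
  | esum : PRel μ n (FreeAlgebra.ι k PGen.e0 + FreeAlgebra.ι k PGen.e1) 1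
  | aL (i : Fin n) :
      PRel μ n (FreeAlgebra.ι k PGen.e0 * FreeAlgebra.ι k (PGen.a i)) (FreeAlgebra.ι k (PGen.a i))
  | aR (i : Fin n) :
      PRel μ n (FreeAlgebra.ι k (PGen.a i) * FreeAlgebra.ι k PGen.e1) (FreeAlgebra.ι k (PGen.a i))
  | asL (i : Fin n) :
      PRel μ n (FreeAlgebra.ι k PGen.e1 * FreeAlgebra.ι k (PGen.as i)) (FreeAlgebra.ι k (PGen.as i))
  | asR (i : Fin n) :
      PRel μ n (FreeAlgebra.ι k (PGen.as i) * FreeAlgebra.ι k PGen.e0) (FreeAlgebra.ι k (PGen.as i))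
  | mu (i : Fin n) :
      PRel μ n (FreeAlgebra.ι k (PGen.as i) * FreeAlgebra.ι k (PGen.a i))
        ((μ - 1) • FreeAlgebra.ι k PGen.e1)

/-- The `k`-category `A^{(n)}` (the μ-central quotient with two objects `{0,1}`),
encoded as a `k`-algebra with idempotents: the `n`-fold coproduct of copies of
`A = A^{(1)}` in the category of `k`-categories with object set `{0,1}`. -/
abbrev PAlg (μ : k) (n : ℕ) : Type := RingQuot (PRel k μ n)

/-- The idempotent `e₀` (identity of the object `0`). -/
noncomputable def e0P (μ : k) (n : ℕ) : PAlg k μ n :=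
  RingQuot.mkAlgHom k (PRel k μ n) (FreeAlgebra.ι k PGen.e0)

/-- The idempotent `e₁` (identity of the object `1`). -/
noncomputable def e1P (μ : k) (n : ℕ) : PAlg k μ n :=
  RingQuot.mkAlgHom k (PRel k μ n) (FreeAlgebra.ι k PGen.e1)

/-- The generating morphism `a_i : 1 → 0`. -/
noncomputable def aP (μ : k) (n : ℕ) (i : Fin n) : PAlg k μ n :=
  RingQuot.mkAlgHom k (PRel k μ n) (FreeAlgebra.ι k (PGen.a i))

/-- The generating morphism `a_i^* : 0 → 1`. -/
noncomputable def asP (μ : k) (n : ℕ) (i : Fin n) : PAlg k μ n :=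
  RingQuot.mkAlgHom k (PRel k μ n) (FreeAlgebra.ι k (PGen.as i))

/-- The invertible endomorphism `T_i = e₀ + a_i a_i^*` of the object `0`. -/
noncomputable def TP (μ : k) (n : ℕ) (i : Fin n) : PAlg k μ n :=
  e0P k μ n + aP k μ n i * asP k μ n i

/-- The inverse `T_i^{-1} = e₀ − μ^{-1} a_i a_i^*` of `T_i` (for `μ` a unit). -/
noncomputable def TinvP (μ : kˣ) (n : ℕ) (i : Fin n) : PAlg k (μ : k) n :=
  e0P k (μ : k) n - ((μ⁻¹ : kˣ) : k) • (aP k (μ : k) n i * asP k (μ : k) n i)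

/-- The strand `i` (as an index in `Fin n`). -/
def lo {n : ℕ} (i : Fin (n - 1)) : Fin n := ⟨i.1, by have := i.isLt; omega⟩
/-- The strand `i+1` (as an index in `Fin n`). -/
def hi {n : ℕ} (i : Fin (n - 1)) : Fin n := ⟨i.1 + 1, by have := i.isLt; omega⟩

/-- The μ-central GMV assignments for the generator `σ_i` acting on `A^{(n)}`:
it fixes both objects `0` and `1` and sends `a_i ↦ T_i a_{i+1}`, `a_{i+1} ↦ a_i`,
`a_i^* ↦ a_{i+1}^* T_i^{-1}`, `a_{i+1}^* ↦ a_i^*`, fixing `a_j, a_j^*` for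
`j ≠ i, i+1`. -/
def IsMuGMVAt (μ : kˣ) (n : ℕ) (i : Fin (n - 1))
    (σ : PAlg k (μ : k) n → PAlg k (μ : k) n) : Prop :=
  σ (e0P k (μ : k) n) = e0P k (μ : k) n ∧
  σ (e1P k (μ : k) n) = e1P k (μ : k) n ∧
  σ (aP k (μ : k) n (lo i)) = TP k (μ : k) n (lo i) * aP k (μ : k) n (hi i) ∧
  σ (aP k (μ : k) n (hi i)) = aP k (μ : k) n (lo i) ∧
  σ (asP k (μ : k) n (lo i)) = asP k (μ : k) n (hi i) * TinvP k μ n (lo i) ∧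
  σ (asP k (μ : k) n (hi i)) = asP k (μ : k) n (lo i) ∧
  (∀ j : Fin n, j ≠ lo i → j ≠ hi i →
    σ (aP k (μ : k) n j) = aP k (μ : k) n j ∧ σ (asP k (μ : k) n j) = asP k (μ : k) n j)

/-- An object of the category `C` of `k`-linear categories with object set `{0,1}`:
a `k`-algebra together with the idempotent `e₀` (the identity of the object `0`;
`e₁ = 1 − e₀`). -/
structure Obj2 (k : Type) [CommRing k] : Type 1 where
  A : Type
  [ring : Ring A]
  [alg : Algebra k A]
  e0 : A
  idem : e0 * e0 = e0

attribute [instance] Obj2.ring Obj2.alg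

/-- A morphism in `C`: an identity-on-objects `k`-linear functor, i.e. a
`k`-algebra homomorphism preserving `e₀`. -/
structure Hom2 {k : Type} [CommRing k] (X Y : Obj2 k) : Type where
  f : X.A →ₐ[k] Y.A
  he : f X.e0 = Y.e0

/-- Composition of morphisms in `C`. -/
def Hom2.comp {k : Type} [CommRing k] {X Y Z : Obj2 k}
    (g : Hom2 Y Z) (f : Hom2 X Y) : Hom2 X Z :=
  ⟨g.f.comp f.f, by simp [f.he, g.he]⟩

/-- The identity morphism in `C`. -/
def Hom2.idH {k : Type} [CommRing k] (X : Obj2 k) : Hom2 X X :=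
  ⟨AlgHom.id k X.A, rfl⟩

/-- A morphism in `C` is an isomorphism if it has a two-sided inverse. -/
def IsIso2 {k : Type} [CommRing k] {X Y : Obj2 k} (f : Hom2 X Y) : Prop :=
  ∃ g : Hom2 Y X, g.comp f = Hom2.idH X ∧ f.comp g = Hom2.idH Y

/-- `p : Y → E` is the coequalizer of `f, g : X → Y` in `C`. -/
def IsCoeq2 {k : Type} [CommRing k] {X Y E : Obj2 k}
    (f g : Hom2 X Y) (p : Hom2 Y E) : Prop :=
  p.comp f = p.comp g ∧
  ∀ (Z : Obj2 k) (h : Hom2 Y Z), h.comp f = h.comp g →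
    ∃! u : Hom2 E Z, u.comp p = h

theorem e0P_idem (μ : k) (n : ℕ) : e0P k μ n * e0P k μ n = e0P k μ n := by
  rw [e0P, ← map_mul]
  exact RingQuot.mkAlgHom_rel k PRel.idem0

/-- The object `A^{(n)}` of `C`. -/
noncomputable def PObj (μ : k) (n : ℕ) : Obj2 k :=
  ⟨PAlg k μ n, e0P k μ n, e0P_idem k μ n⟩

theorem Hom2.ext_f {k : Type} [CommRing k] {X Y : Obj2 k} {f g : Hom2 X Y}
    (h : f.f = g.f) : f = g := by
  cases f; cases g; cases h; rfl

section Relations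

variable (μ : k) (n : ℕ)

theorem e0P_add_e1P : e0P k μ n + e1P k μ n = 1 := by
  rw [e0P, e1P, ← map_add, ← map_one (RingQuot.mkAlgHom k (PRel k μ n))]
  exact RingQuot.mkAlgHom_rel k PRel.esum

theorem e1P_eq : e1P k μ n = 1 - e0P k μ n :=
  eq_sub_of_add_eq' (e0P_add_e1P k μ n)

theorem e0P_mul_aP (i : Fin n) : e0P k μ n * aP k μ n i = aP k μ n i := by
  rw [e0P, aP, ← map_mul]
  exact RingQuot.mkAlgHom_rel k (PRel.aL i)

theorem aP_mul_e1P (i : Fin n) : aP k μ n i * e1P k μ n = aP k μ n i := by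
  rw [e1P, aP, ← map_mul]
  exact RingQuot.mkAlgHom_rel k (PRel.aR i)

theorem e1P_mul_asP (i : Fin n) : e1P k μ n * asP k μ n i = asP k μ n i := by
  rw [e1P, asP, ← map_mul]
  exact RingQuot.mkAlgHom_rel k (PRel.asL i)

theorem asP_mul_e0P (i : Fin n) : asP k μ n i * e0P k μ n = asP k μ n i := by
  rw [e0P, asP, ← map_mul]
  exact RingQuot.mkAlgHom_rel k (PRel.asR i)

theorem asP_mul_aP (i : Fin n) :
    asP k μ n i * aP k μ n i = (μ - 1) • e1P k μ n := by
  rw [e1P, asP, aP, ← map_mul, ← map_smul]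
  exact RingQuot.mkAlgHom_rel k (PRel.mu i)

theorem aP_mul_e0P (i : Fin n) : aP k μ n i * e0P k μ n = 0 := by
  have h := aP_mul_e1P k μ n i
  rw [e1P_eq, mul_sub, mul_one] at h
  simpa using h

theorem e0P_mul_asP (i : Fin n) : e0P k μ n * asP k μ n i = 0 := by
  have h := e1P_mul_asP k μ n i
  rw [e1P_eq, sub_mul, one_mul] at h
  simpa using h

theorem e0P_mul_TP (i : Fin n) : e0P k μ n * TP k μ n i = TP k μ n i := by
  rw [TP, mul_add, e0P_idem, ← mul_assoc, e0P_mul_aP]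

theorem TP_mul_e0P (i : Fin n) : TP k μ n i * e0P k μ n = TP k μ n i := by
  rw [TP, add_mul, e0P_idem, mul_assoc, asP_mul_e0P]

theorem TP_mul_aP (i : Fin n) : TP k μ n i * aP k μ n i = μ • aP k μ n i := by
  rw [TP, add_mul, e0P_mul_aP, mul_assoc, asP_mul_aP, mul_smul_comm, aP_mul_e1P]
  module

end Relations

section Inverse

variable (μ : kˣ) (n : ℕ) (i : Fin n)

theorem e0P_mul_TinvP : e0P k (μ : k) n * TinvP k μ n i = TinvP k μ n i := by
  rw [TinvP, mul_sub, e0P_idem, mul_smul_comm, ← mul_assoc, e0P_mul_aP]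

theorem TinvP_mul_e0P : TinvP k μ n i * e0P k (μ : k) n = TinvP k μ n i := by
  rw [TinvP, sub_mul, e0P_idem, smul_mul_assoc, mul_assoc, asP_mul_e0P]

theorem TP_mul_TinvP : TP k (μ : k) n i * TinvP k μ n i = e0P k (μ : k) n := by
  rw [TinvP, mul_sub, TP_mul_e0P, mul_smul_comm, ← mul_assoc, TP_mul_aP, smul_mul_assoc,
    smul_smul, Units.inv_mul, one_smul, TP, add_sub_cancel_right]

theorem asP_mul_TinvP :
    asP k (μ : k) n i * TinvP k μ n i = ((μ⁻¹ : kˣ) : k) • asP k (μ : k) n i := by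
  rw [TinvP, mul_sub, asP_mul_e0P, mul_smul_comm, ← mul_assoc, asP_mul_aP, smul_mul_assoc,
    e1P_mul_asP, smul_smul, mul_sub, Units.inv_mul, mul_one, sub_smul, one_smul, sub_sub_cancel]

theorem TinvP_mul_TP : TinvP k μ n i * TP k (μ : k) n i = e0P k (μ : k) n := by
  rw [TP, mul_add, TinvP_mul_e0P, TinvP, sub_mul, ← mul_assoc, e0P_mul_aP, smul_mul_assoc,
    ← mul_assoc, mul_assoc (aP k (μ : k) n i), asP_mul_aP, mul_smul_comm, aP_mul_e1P,
    smul_mul_assoc, smul_smul, mul_sub, Units.inv_mul, mul_one, sub_smul, one_smul]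
  abel

theorem TP_mul_TinvP_mul (x : PAlg k (μ : k) n) :
    TP k (μ : k) n i * (TinvP k μ n i * x) = e0P k (μ : k) n * x := by
  rw [← mul_assoc, TP_mul_TinvP]

theorem TinvP_mul_TP_mul (x : PAlg k (μ : k) n) :
    TinvP k μ n i * (TP k (μ : k) n i * x) = e0P k (μ : k) n * x := by
  rw [← mul_assoc, TinvP_mul_TP]

end Inverse

section Lift

variable {k} {μ : k} {n : ℕ} {B : Type} [Ring B] [Algebra k B]

/-- Elements of `B` at which the generators of `A^{(n)}` can be evaluated, the identity of the
object `0` being sent to `e`. -/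
structure IsPRep (μ : k) {n : ℕ} (e : B) (x y : Fin n → B) : Prop where
  idem : e * e = e
  left_a (i : Fin n) : e * x i = x i
  right_a (i : Fin n) : x i * e = 0
  left_as (i : Fin n) : e * y i = 0
  right_as (i : Fin n) : y i * e = y i
  central (i : Fin n) : y i * x i = (μ - 1) • (1 - e)

/-- The values on generators of the functor determined by `e`, `x`, `y`. -/
def pGenVal (e : B) (x y : Fin n → B) : PGen n → B
  | .e0 => e
  | .e1 => 1 - e
  | .a i => x i
  | .as i => y i

/-- The universal property of `A^{(n)}`. -/
noncomputable def pLift {e : B} {x y : Fin n → B} (h : IsPRep μ e x y) : PAlg k μ n →ₐ[k] B :=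
  RingQuot.liftAlgHom k ⟨FreeAlgebra.lift k (pGenVal e x y), by
    rintro _ _ (_ | _)
    all_goals
      simp [pGenVal, h.idem, h.left_a, h.right_a, h.left_as, h.right_as, h.central,
        mul_sub, sub_mul]⟩

variable {e : B} {x y : Fin n → B} (h : IsPRep μ e x y)

@[simp] theorem pLift_e0P : pLift h (e0P k μ n) = e := by
  simp [pLift, e0P, pGenVal]

@[simp] theorem pLift_aP (i : Fin n) : pLift h (aP k μ n i) = x i := by
  simp [pLift, aP, pGenVal]

@[simp] theorem pLift_asP (i : Fin n) : pLift h (asP k μ n i) = y i := by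
  simp [pLift, asP, pGenVal]

theorem map_e1P {f : PAlg k μ n →ₐ[k] B} (he : f (e0P k μ n) = e) :
    f (e1P k μ n) = 1 - e := by
  rw [e1P_eq, map_sub, map_one, he]

theorem PAlg.algHom_ext {f g : PAlg k μ n →ₐ[k] B} (he : f (e0P k μ n) = g (e0P k μ n))
    (ha : ∀ i, f (aP k μ n i) = g (aP k μ n i))
    (has : ∀ i, f (asP k μ n i) = g (asP k μ n i)) : f = g := by
  apply RingQuot.ringQuot_ext'
  apply FreeAlgebra.hom_ext
  funext t
  cases t with
  | e0 => exact he
  | e1 => exact (map_e1P rfl).trans ((congrArg _ he).trans (map_e1P rfl).symm)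
  | a i => exact ha i
  | as i => exact has i

end Lift

section GMV

variable {k} {μ : kˣ} {n : ℕ}

theorem isPRep_gMV : IsPRep (μ : k) (e0P k (μ : k) 2)
    ![TP k (μ : k) 2 0 * aP k (μ : k) 2 1, aP k (μ : k) 2 0]
    ![asP k (μ : k) 2 1 * TinvP k μ 2 0, asP k (μ : k) 2 0] where
  idem := e0P_idem _ _ _
  left_a i := by fin_cases i <;> simp [← mul_assoc, e0P_mul_TP, e0P_mul_aP]
  right_a i := by fin_cases i <;> simp [mul_assoc, aP_mul_e0P]
  left_as i := by fin_cases i <;> simp [← mul_assoc, e0P_mul_asP]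
  right_as i := by fin_cases i <;> simp [mul_assoc, TinvP_mul_e0P, asP_mul_e0P]
  central i := by
    rw [← e1P_eq]
    fin_cases i <;> simp [mul_assoc, TinvP_mul_TP_mul, e0P_mul_aP, asP_mul_aP]

theorem isPRep_gMV_inv : IsPRep (μ : k) (e0P k (μ : k) 2)
    ![aP k (μ : k) 2 1, TinvP k μ 2 1 * aP k (μ : k) 2 0]
    ![asP k (μ : k) 2 1, asP k (μ : k) 2 0 * TP k (μ : k) 2 1] where
  idem := e0P_idem _ _ _
  left_a i := by fin_cases i <;> simp [← mul_assoc, e0P_mul_TinvP, e0P_mul_aP]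
  right_a i := by fin_cases i <;> simp [mul_assoc, aP_mul_e0P]
  left_as i := by fin_cases i <;> simp [← mul_assoc, e0P_mul_asP]
  right_as i := by fin_cases i <;> simp [mul_assoc, TP_mul_e0P, asP_mul_e0P]
  central i := by
    rw [← e1P_eq]
    fin_cases i <;> simp [mul_assoc, TP_mul_TinvP_mul, e0P_mul_aP, asP_mul_aP]

theorem gMV_inv_comp_gMV :
    (pLift (isPRep_gMV_inv (μ := μ))).comp (pLift (isPRep_gMV (μ := μ))) =
      AlgHom.id k (PAlg k (μ : k) 2) := by
  apply PAlg.algHom_ext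
  · simp
  · intro i
    fin_cases i
    · have hT : pLift (isPRep_gMV_inv (μ := μ)) (TP k (μ : k) 2 0) = TP k (μ : k) 2 1 := by
        simp [TP]
      simp [hT, TP_mul_TinvP_mul, e0P_mul_aP]
    · simp
  · intro i
    fin_cases i
    · have hT : pLift (isPRep_gMV_inv (μ := μ)) (TinvP k μ 2 0) = TinvP k μ 2 1 := by
        simp [TinvP]
      simp [hT, mul_assoc, TP_mul_TinvP, asP_mul_e0P]
    · simp

theorem gMV_comp_gMV_inv :
    (pLift (isPRep_gMV (μ := μ))).comp (pLift (isPRep_gMV_inv (μ := μ))) =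
      AlgHom.id k (PAlg k (μ : k) 2) := by
  apply PAlg.algHom_ext
  · simp
  · intro i
    fin_cases i
    · simp
    · have hT : pLift (isPRep_gMV (μ := μ)) (TinvP k μ 2 1) = TinvP k μ 2 0 := by
        simp [TinvP]
      simp [hT, TinvP_mul_TP_mul, e0P_mul_aP]
  · intro i
    fin_cases i
    · simp
    · have hT : pLift (isPRep_gMV (μ := μ)) (TP k (μ : k) 2 1) = TP k (μ : k) 2 0 := by
        simp [TP]
      simp [hT, mul_assoc, TinvP_mul_TP, asP_mul_e0P]

section Action

variable {i : Fin (n - 1)} {s : PAlg k (μ : k) n →ₐ[k] PAlg k (μ : k) n}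

theorem IsMuGMVAt.map_TP_lo (h : IsMuGMVAt k μ n i s) :
    s (TP k (μ : k) n (lo i)) =
    TP k (μ : k) n (lo i) * (TP k (μ : k) n (hi i) * TinvP k μ n (lo i)) := by
  obtain ⟨h0, -, ha, -, has, -⟩ := h
  rw [TP.eq_1 k _ _ (hi i), add_mul, e0P_mul_TinvP, mul_add, TP_mul_TinvP, TP, map_add, map_mul,
    h0, ha, has, TP]
  simp only [mul_assoc]

theorem IsMuGMVAt.map_TinvP_lo (h : IsMuGMVAt k μ n i s) :
    s (TinvP k μ n (lo i)) =
    TP k (μ : k) n (lo i) * (TinvP k μ n (hi i) * TinvP k μ n (lo i)) := by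
  obtain ⟨h0, -, ha, -, has, -⟩ := h
  rw [TinvP.eq_1 k _ _ (hi i), sub_mul, e0P_mul_TinvP, mul_sub, TP_mul_TinvP, TinvP.eq_1, map_sub,
    map_smul, map_mul, h0, ha, has]
  simp only [mul_assoc, TinvP, smul_mul_assoc, mul_smul_comm]

theorem IsMuGMVAt.map_TP_hi (h : IsMuGMVAt k μ n i s) :
    s (TP k (μ : k) n (hi i)) = TP k (μ : k) n (lo i) := by
  obtain ⟨h0, -, -, ha, -, has, -⟩ := h
  rw [TP, map_add, map_mul, h0, ha, has, TP]

theorem IsMuGMVAt.map_TinvP_hi (h : IsMuGMVAt k μ n i s) :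
    s (TinvP k μ n (hi i)) = TinvP k μ n (lo i) := by
  obtain ⟨h0, -, -, ha, -, has, -⟩ := h
  rw [TinvP, map_sub, map_smul, map_mul, h0, ha, has, TinvP]

theorem IsMuGMVAt.map_TP_of_ne (h : IsMuGMVAt k μ n i s)
    {j : Fin n} (hl : j ≠ lo i) (hh : j ≠ hi i) :
    s (TP k (μ : k) n j) = TP k (μ : k) n j := by
  obtain ⟨h0, -, -, -, -, -, hj⟩ := h
  rw [TP, map_add, map_mul, h0, (hj j hl hh).1, (hj j hl hh).2]

theorem IsMuGMVAt.map_TinvP_of_ne (h : IsMuGMVAt k μ n i s)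
    {j : Fin n} (hl : j ≠ lo i) (hh : j ≠ hi i) :
    s (TinvP k μ n j) = TinvP k μ n j := by
  obtain ⟨h0, -, -, -, -, -, hj⟩ := h
  rw [TinvP, map_sub, map_smul, map_mul, h0, (hj j hl hh).1, (hj j hl hh).2]

end Action

theorem gMV_yangBaxter {s t : PAlg k (μ : k) 3 →ₐ[k] PAlg k (μ : k) 3}
    (hs : IsMuGMVAt k μ 3 0 s) (ht : IsMuGMVAt k μ 3 1 t) :
    (t.comp s).comp t = (s.comp t).comp s := by
  have l0 : lo (0 : Fin (3 - 1)) = (0 : Fin 3) := rfl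
  have l1 : lo (1 : Fin (3 - 1)) = (1 : Fin 3) := rfl
  have h0 : hi (0 : Fin (3 - 1)) = (1 : Fin 3) := rfl
  have h1 : hi (1 : Fin (3 - 1)) = (2 : Fin 3) := rfl
  have sT0 := hs.map_TP_lo
  have sT1 := hs.map_TP_hi
  have sI0 := hs.map_TinvP_lo
  have sI1 := hs.map_TinvP_hi
  have tT0 := ht.map_TP_of_ne (j := 0) (by decide) (by decide)
  have tI0 := ht.map_TinvP_of_ne (j := 0) (by decide) (by decide)
  obtain ⟨s0, -, sa0, sa1, sas0, sas1, sj⟩ := hs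
  obtain ⟨t0, -, ta1, ta2, tas1, tas2, tj⟩ := ht
  obtain ⟨sa2, sas2⟩ := sj 2 (by decide) (by decide)
  obtain ⟨ta0, tas0⟩ := tj 0 (by decide) (by decide)
  simp only [l0, l1, h0, h1] at *
  apply PAlg.algHom_ext
  · simp [s0, t0]
  · intro i
    fin_cases i <;>
      simp [sa0, sa1, sa2, ta0, ta1, ta2, sT0, sT1, tT0, mul_assoc, TinvP_mul_TP_mul,
        e0P_mul_aP]
  · intro i
    fin_cases i <;>
      simp [sas0, sas1, sas2, tas0, tas1, tas2, sI0, sI1, tI0, mul_assoc, TinvP_mul_TP_mul]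
    rw [← mul_assoc (e0P k (μ : k) 3), e0P_mul_TinvP]

end GMV

section Torsion

variable {k} {μ : kˣ}

theorem isPRep_fold : IsPRep (μ : k) (n := 2) (e0P k (μ : k) 1)
    (fun _ => aP k (μ : k) 1 0) (fun _ => asP k (μ : k) 1 0) where
  idem := e0P_idem _ _ _
  left_a _ := e0P_mul_aP _ _ _ _
  right_a _ := aP_mul_e0P _ _ _ _
  left_as _ := e0P_mul_asP _ _ _ _
  right_as _ := asP_mul_e0P _ _ _ _
  central _ := by rw [asP_mul_aP, e1P_eq]

theorem isPRep_scale (c : kˣ) : IsPRep (μ : k) (n := 1) (e0P k (μ : k) 1)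
    (fun i => (c : k) • aP k (μ : k) 1 i) (fun i => ((c⁻¹ : kˣ) : k) • asP k (μ : k) 1 i) where
  idem := e0P_idem _ _ _
  left_a _ := by rw [mul_smul_comm, e0P_mul_aP]
  right_a _ := by rw [smul_mul_assoc, aP_mul_e0P, smul_zero]
  left_as _ := by rw [mul_smul_comm, e0P_mul_asP, smul_zero]
  right_as _ := by rw [smul_mul_assoc, asP_mul_e0P]
  central _ := by
    rw [smul_mul_assoc, mul_smul_comm, smul_smul, Units.inv_mul, one_smul, asP_mul_aP, e1P_eq]

theorem scale_comp_scale {c d : kˣ} (hcd : c * d = 1) :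
    (pLift (isPRep_scale (μ := μ) c)).comp (pLift (isPRep_scale d)) =
      AlgHom.id k (PAlg k (μ : k) 1) := by
  obtain rfl : d = c⁻¹ := (inv_eq_of_mul_eq_one_right hcd).symm
  apply PAlg.algHom_ext <;> simp [smul_smul]

end Torsion

theorem statement6 (μ : kˣ)
    -- i₁, i₂ : A → A^{(2)} are the coproduct inclusions
    (i₁ i₂ : Hom2 (PObj k (μ : k) 1) (PObj k (μ : k) 2))
    (hi₁ : i₁.f (e1P k (μ : k) 1) = e1P k (μ : k) 2 ∧
      i₁.f (aP k (μ : k) 1 0) = aP k (μ : k) 2 0 ∧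
      i₁.f (asP k (μ : k) 1 0) = asP k (μ : k) 2 0)
    (hi₂ : i₂.f (e1P k (μ : k) 1) = e1P k (μ : k) 2 ∧
      i₂.f (aP k (μ : k) 1 0) = aP k (μ : k) 2 1 ∧
      i₂.f (asP k (μ : k) 1 0) = asP k (μ : k) 2 1) :
    ∃ σ : Hom2 (PObj k (μ : k) 2) (PObj k (μ : k) 2),
      -- σ is the μ-central GMV operator …
      IsMuGMVAt k μ 2 0 (σ.f : PAlg k (μ : k) 2 → PAlg k (μ : k) 2) ∧
      -- … and it is Reidemeister:
      -- (a) σ is invertible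
      IsIso2 σ ∧
      -- (b) σ is Yang–Baxter: σ₂₃σ₁₂σ₂₃ = σ₁₂σ₂₃σ₁₂ on A^{(3)}
      (∀ σ12 σ23 : Hom2 (PObj k (μ : k) 3) (PObj k (μ : k) 3),
        IsMuGMVAt k μ 3 0 (σ12.f : PAlg k (μ : k) 3 → PAlg k (μ : k) 3) →
        IsMuGMVAt k μ 3 1 (σ23.f : PAlg k (μ : k) 3 → PAlg k (μ : k) 3) →
        ∀ x, σ23.f (σ12.f (σ23.f x)) = σ12.f (σ23.f (σ12.f x))) ∧
      -- (c) σ^R_U = (σ∘i₂, i₂) and σ^L_U = (σ∘i₁, i₁) are invertible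
      (∃ σRU : Hom2 (PObj k (μ : k) 2) (PObj k (μ : k) 2),
        (∀ x, σRU.f (i₁.f x) = σ.f (i₂.f x)) ∧ (∀ x, σRU.f (i₂.f x) = i₂.f x) ∧
        IsIso2 σRU) ∧
      (∃ σLU : Hom2 (PObj k (μ : k) 2) (PObj k (μ : k) 2),
        (∀ x, σLU.f (i₁.f x) = σ.f (i₁.f x)) ∧ (∀ x, σLU.f (i₂.f x) = i₁.f x) ∧
        IsIso2 σLU) ∧
      -- (d) σ is Wada with torsion χ : a ↦ Ta, a^* ↦ a^*T⁻¹, which is invertible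
      (∃ (E : Obj2 k) (p : Hom2 (PObj k (μ : k) 2) E),
        IsCoeq2 i₂ (σ.comp i₂) p ∧
        IsIso2 (p.comp i₁) ∧
        ∃ χ : Hom2 (PObj k (μ : k) 1) (PObj k (μ : k) 1),
          χ.f (e1P k (μ : k) 1) = e1P k (μ : k) 1 ∧
          χ.f (aP k (μ : k) 1 0) = TP k (μ : k) 1 0 * aP k (μ : k) 1 0 ∧
          χ.f (asP k (μ : k) 1 0) = asP k (μ : k) 1 0 * TinvP k μ 1 0 ∧
          IsIso2 χ ∧
          (p.comp i₁).comp χ = p.comp (σ.comp i₁)) := by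
  obtain ⟨-, ha₁, has₁⟩ := hi₁
  obtain ⟨-, ha₂, has₂⟩ := hi₂
  have he₁ : i₁.f (e0P k (μ : k) 1) = e0P k (μ : k) 2 := i₁.he
  have he₂ : i₂.f (e0P k (μ : k) 1) = e0P k (μ : k) 2 := i₂.he
  obtain ⟨j₁, hj₁⟩ : ∃ j : PAlg k (μ : k) 1 →ₐ[k] PAlg k (μ : k) 2, j = i₁.f := ⟨_, rfl⟩
  obtain ⟨j₂, hj₂⟩ : ∃ j : PAlg k (μ : k) 1 →ₐ[k] PAlg k (μ : k) 2, j = i₂.f := ⟨_, rfl⟩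
  replace ha₁ : j₁ (aP k (μ : k) 1 0) = aP k (μ : k) 2 0 := hj₁ ▸ ha₁
  replace ha₂ : j₂ (aP k (μ : k) 1 0) = aP k (μ : k) 2 1 := hj₂ ▸ ha₂
  replace has₁ : j₁ (asP k (μ : k) 1 0) = asP k (μ : k) 2 0 := hj₁ ▸ has₁
  replace has₂ : j₂ (asP k (μ : k) 1 0) = asP k (μ : k) 2 1 := hj₂ ▸ has₂
  replace he₁ : j₁ (e0P k (μ : k) 1) = e0P k (μ : k) 2 := hj₁ ▸ he₁
  replace he₂ : j₂ (e0P k (μ : k) 1) = e0P k (μ : k) 2 := hj₂ ▸ he₂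
  let s := pLift (isPRep_gMV (μ := μ))
  let p := pLift (isPRep_fold (μ := μ))
  have hsj : s.comp j₂ = j₁ := by
    apply PAlg.algHom_ext
    · simp [s, he₁, he₂]
    all_goals
      intro i
      fin_cases i
      simp [s, ha₁, ha₂, has₁, has₂]
  have hpj₁ : p.comp j₁ = AlgHom.id k _ := by
    apply PAlg.algHom_ext
    · simp [p, he₁]
    all_goals
      intro i
      fin_cases i
      simp [p, ha₁, has₁]
  have hpj₂ : p.comp j₂ = AlgHom.id k _ := by
    apply PAlg.algHom_ext
    · simp [p, he₂]
    all_goals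
      intro i
      fin_cases i
      simp [p, ha₂, has₂]
  have hfactor {B : Type} [Ring B] [Algebra k B] (q : PAlg k (μ : k) 2 →ₐ[k] B)
      (hq : q.comp j₂ = q.comp j₁) : (q.comp j₁).comp p = q := by
    have hqa := DFunLike.congr_fun hq (aP k (μ : k) 1 0)
    have hqas := DFunLike.congr_fun hq (asP k (μ : k) 1 0)
    simp only [AlgHom.comp_apply, ha₁, ha₂, has₁, has₂] at hqa hqas
    apply PAlg.algHom_ext
    · simp [p, he₁]
    · intro i
      fin_cases i <;> simp [p, ha₁, hqa]
    · intro i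
      fin_cases i <;> simp [p, has₁, hqas]
  have hχ : pLift (isPRep_scale μ) = p.comp (s.comp j₁) := by
    have hT : p (TP k (μ : k) 2 0) = TP k (μ : k) 1 0 := by simp [p, TP]
    have hI : p (TinvP k μ 2 0) = TinvP k μ 1 0 := by simp [p, TinvP]
    apply PAlg.algHom_ext
    · simp [p, s, he₁]
    · intro i
      fin_cases i
      simp only [AlgHom.comp_apply, Fin.zero_eta, ha₁, s, pLift_aP, Matrix.cons_val_zero, map_mul,
        hT]
      simp [p, TP_mul_aP]
    · intro i
      fin_cases i
      simp only [AlgHom.comp_apply, Fin.zero_eta, has₁, s, pLift_asP, Matrix.cons_val_zero, map_mul,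
        hI]
      simp [p, asP_mul_TinvP]
  let σ : Hom2 (PObj k (μ : k) 2) (PObj k (μ : k) 2) := ⟨s, pLift_e0P isPRep_gMV⟩
  let P : Hom2 (PObj k (μ : k) 2) (PObj k (μ : k) 1) := ⟨p, pLift_e0P isPRep_fold⟩
  have hσi : σ.comp i₂ = i₁ := Hom2.ext_f (by subst hj₁ hj₂; exact hsj)
  have hPi₁ : P.comp i₁ = Hom2.idH _ := Hom2.ext_f (by subst hj₁; exact hpj₁)
  have hPi₂ : P.comp i₂ = Hom2.idH _ := Hom2.ext_f (by subst hj₂; exact hpj₂)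
  have hσ : IsIso2 σ := ⟨⟨pLift isPRep_gMV_inv, pLift_e0P isPRep_gMV_inv⟩,
    Hom2.ext_f gMV_inv_comp_gMV, Hom2.ext_f gMV_comp_gMV_inv⟩
  have hσi' : ∀ x, σ.f (i₂.f x) = i₁.f x := fun x => congrArg (fun g => g.f x) hσi
  refine ⟨σ, ⟨pLift_e0P isPRep_gMV, (map_e1P (pLift_e0P isPRep_gMV)).trans (e1P_eq _ _ _).symm,
      pLift_aP isPRep_gMV 0, pLift_aP isPRep_gMV 1, pLift_asP isPRep_gMV 0,
      pLift_asP isPRep_gMV 1, ?_⟩, hσ,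
    fun _ _ h12 h23 x => DFunLike.congr_fun (gMV_yangBaxter h12 h23) x,
    ⟨Hom2.idH _, fun x => (hσi' x).symm, fun _ => rfl, Hom2.idH _, rfl, rfl⟩,
    ⟨σ, fun _ => rfl, hσi', hσ⟩, PObj k (μ : k) 1, P, ⟨?_, fun Z h hh => ?_⟩,
    ⟨Hom2.idH _, ?_, ?_⟩, ⟨pLift (isPRep_scale μ), pLift_e0P (isPRep_scale μ)⟩, ?_, ?_, ?_, ?_, ?_⟩
  · intro j hl hh
    fin_cases j
    · exact absurd rfl hl
    · exact absurd rfl hh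
  · rw [hσi, hPi₁, hPi₂]
  · rw [hσi] at hh
    refine ⟨h.comp i₁, Hom2.ext_f ?_, fun u hu => ?_⟩
    · subst hj₁ hj₂
      exact hfactor h.f (congrArg Hom2.f hh)
    · rw [← hu]
      change u = u.comp (P.comp i₁)
      rw [hPi₁]
      rfl
  · rw [hPi₁]; rfl
  · rw [hPi₁]; rfl
  · exact (map_e1P (pLift_e0P (isPRep_scale μ))).trans (e1P_eq _ _ _).symm
  · exact (pLift_aP (isPRep_scale μ) 0).trans (TP_mul_aP _ _ _ _).symm
  · exact (pLift_asP (isPRep_scale μ) 0).trans (asP_mul_TinvP _ _ _ _).symm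
  · exact ⟨⟨pLift (isPRep_scale μ⁻¹), pLift_e0P (isPRep_scale μ⁻¹)⟩,
      Hom2.ext_f (scale_comp_scale (inv_mul_cancel μ)),
      Hom2.ext_f (scale_comp_scale (mul_inv_cancel μ))⟩
  · rw [hPi₁]
    refine Hom2.ext_f ?_
    subst hj₁
    exact hχ
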